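/- Suppose F(z|τ) and G(z|τ) are entire functions of z satisfying F(z|τ) = F(z+π|τ) = q³ e^{12iz} F(z+πτ|τ) and G(z|τ) = G(z+π|τ) = q³ e^{12iz} G(z+πτ|τ) for all z ∈ ℂ. Then there exists a constant C ∈ ℂ, independent of x and y, such that for all x, y ∈ ℂ: (F(x|τ) − F(−x|τ))(G(y|τ) − G(−y|τ)) − (F(y|τ) − F(−y|τ))(G(x|τ) − G(−x|τ)) = C·θ₁(x−y|τ)θ₁(x+y|τ)θ₁(2x|τ)θ₁(2y|τ). -/

import Mathlib

noncomputable section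

open Complex

namespace Liu

/-- `π` as a complex number. -/
def piC : ℂ := Real.pi

/-- The nome `q = exp(2πiτ)`. -/
def qq (τ : ℂ) : ℂ := exp (2 * piC * I * τ)

/-- Jacobi theta function θ₁(z|τ). -/
def theta1 (z τ : ℂ) : ℂ :=
  -I * exp (piC * I * τ / 4) *
    ∑' n : ℤ, (-1 : ℂ) ^ n * exp (piC * I * τ * (n : ℂ) * ((n : ℂ) + 1)) *
      exp ((2 * (n : ℂ) + 1) * I * z)

/-- Jacobi theta function θ₂(z|τ). -/
def theta2 (z τ : ℂ) : ℂ :=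
  2 * ∑' n : ℕ, exp (piC * I * τ * (2 * (n : ℂ) + 1) ^ 2 / 4) * cos ((2 * (n : ℂ) + 1) * z)

/-- Jacobi theta function θ₃(z|τ). -/
def theta3 (z τ : ℂ) : ℂ :=
  1 + 2 * ∑' n : ℕ, exp (piC * I * τ * ((n : ℂ) + 1) ^ 2) * cos (2 * ((n : ℂ) + 1) * z)

/-- Jacobi theta function θ₄(z|τ). -/
def theta4 (z τ : ℂ) : ℂ :=
  1 + 2 * ∑' n : ℕ, (-1 : ℂ) ^ (n + 1) * exp (piC * I * τ * ((n : ℂ) + 1) ^ 2) *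
    cos (2 * ((n : ℂ) + 1) * z)

/-- θ₁'(τ) = (∂θ₁/∂z)(0|τ). -/
def theta1' (τ : ℂ) : ℂ := deriv (fun z => theta1 z τ) 0

/-- The Dedekind eta function. -/
def eta (τ : ℂ) : ℂ := exp (piC * I * τ / 12) * ∏' n : ℕ, (1 - qq τ ^ (n + 1))

/-- Eisenstein series L = E₂. -/
def EisL (τ : ℂ) : ℂ :=
  1 - 24 * ∑' n : ℕ, ((n : ℂ) + 1) * qq τ ^ (n + 1) / (1 - qq τ ^ (n + 1))

/-- Eisenstein series M = E₄. -/
def EisM (τ : ℂ) : ℂ :=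
  1 + 240 * ∑' n : ℕ, ((n : ℂ) + 1) ^ 3 * qq τ ^ (n + 1) / (1 - qq τ ^ (n + 1))

/-- The period lattice Λ = {mπ + nπτ : m, n ∈ ℤ}. -/
def Lambda (τ : ℂ) : Set ℂ := {z | ∃ m n : ℤ, z = (m : ℂ) * piC + (n : ℂ) * piC * τ}

/-- The Weierstrass ℘ function attached to the lattice with periods π and πτ. -/
def wp (τ z : ℂ) : ℂ :=
  1 / z ^ 2 + ∑' p : ℤ × ℤ,
    if p = (0, 0) then 0
    else 1 / (z - ((p.1 : ℂ) * piC + (p.2 : ℂ) * piC * τ)) ^ 2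
      - 1 / ((p.1 : ℂ) * piC + (p.2 : ℂ) * piC * τ) ^ 2

/-- The zeroth Fourier coefficient of `jacobiTheta₂` in its first variable is `1`. -/
lemma integral_jacobiTheta₂ {τ : ℂ} (hτ : 0 < τ.im) :
    ∫ x in (0 : ℝ)..1, jacobiTheta₂ x τ = 1 := by
  have hterm : ∀ n : ℤ, ∫ x in (0 : ℝ)..1, jacobiTheta₂_term n x τ = if n = 0 then 1 else 0 := by
    intro n
    split_ifs with hn
    · simp [hn, jacobiTheta₂_term]
    · have hc : 2 * (Real.pi : ℂ) * I * n ≠ 0 := by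
        simp [hn, Real.pi_ne_zero]
      have h1 : exp (2 * (Real.pi : ℂ) * I * n) = 1 := by
        rw [mul_comm]
        exact exp_int_mul_two_pi_mul_I n
      simp only [jacobiTheta₂_term, exp_add]
      rw [intervalIntegral.integral_mul_const, integral_exp_mul_complex hc]
      simp [h1]
  have hsum : HasSum (fun n : ℤ => ∫ x in (0 : ℝ)..1, jacobiTheta₂_term n x τ)
      (∫ x in (0 : ℝ)..1, jacobiTheta₂ x τ) := by
    refine intervalIntegral.hasSum_integral_of_dominated_convergence
      (fun n _ => ‖jacobiTheta₂_term n 0 τ‖) (fun n => ?_) (fun n => ?_) ?_ ?_ ?_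
    · have : Continuous fun x : ℝ => jacobiTheta₂_term n x τ := by
        unfold jacobiTheta₂_term
        fun_prop
      exact this.aestronglyMeasurable
    · refine Filter.Eventually.of_forall fun x _ => ?_
      simp [norm_jacobiTheta₂_term]
    · exact Filter.Eventually.of_forall fun x _ =>
        ((summable_jacobiTheta₂_term_iff 0 τ).2 hτ).norm
    · exact intervalIntegrable_const
    · exact Filter.Eventually.of_forall fun x _ => hasSum_jacobiTheta₂_term _ hτ
  simp only [hterm] at hsum
  exact hsum.unique (hasSum_ite_eq 0 1)

lemma piC_ne_zero : piC ≠ 0 := by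
  simp [piC, Real.pi_ne_zero]

lemma exp_piC_mul_I : exp (piC * I) = -1 := exp_pi_mul_I

/-- `θ₁` in terms of Mathlib's two-variable theta function. -/
lemma theta1_eq_jacobiTheta₂ (z τ : ℂ) :
    theta1 z τ = -I * exp (piC * I * τ / 4) *
      (exp (I * z) * jacobiTheta₂ (z / piC + (τ + 1) / 2) τ) := by
  rw [theta1, jacobiTheta₂, ← mul_assoc, ← tsum_mul_left, ← tsum_mul_left]
  refine tsum_congr fun n => ?_
  have h1 : (-1 : ℂ) ^ n = exp (n * (piC * I)) := by
    rw [exp_int_mul, exp_piC_mul_I]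
  rw [h1, jacobiTheta₂_term, mul_assoc _ (exp (I * z)), ← exp_add, ← exp_add, ← exp_add]
  congr 2
  change _ = I * z + (2 * piC * I * n * (z / piC + (τ + 1) / 2) + piC * I * n ^ 2 * τ)
  field_simp [piC_ne_zero]
  ring

lemma differentiable_theta1 {τ : ℂ} (hτ : 0 < τ.im) :
    Differentiable ℂ fun z => theta1 z τ := by
  have h : Differentiable ℂ fun z => jacobiTheta₂ z τ :=
    fun z => differentiableAt_jacobiTheta₂_fst z hτ
  have h' : Differentiable ℂ fun z => jacobiTheta₂ (z / piC + (τ + 1) / 2) τ :=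
    h.comp (f := fun z => z / piC + (τ + 1) / 2) (by fun_prop)
  simp only [theta1_eq_jacobiTheta₂]
  fun_prop

lemma theta1_add_pi (z τ : ℂ) : theta1 (z + piC) τ = -theta1 z τ := by
  rw [theta1_eq_jacobiTheta₂, theta1_eq_jacobiTheta₂,
    show (z + piC) / piC + (τ + 1) / 2 = z / piC + (τ + 1) / 2 + 1 by
      field_simp [piC_ne_zero]; ring,
    jacobiTheta₂_add_left, mul_add, exp_add, mul_comm I piC, exp_piC_mul_I]
  ring

lemma theta1_add_pi_mul (z τ : ℂ) :
    theta1 (z + piC * τ) τ = -exp (-(piC * I * τ + 2 * I * z)) * theta1 z τ := by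
  have h : exp (-(piC : ℂ) * I * (τ + 2 * (z / piC + (τ + 1) / 2))) =
      -exp (-(2 * piC * I * τ + 2 * I * z)) := by
    rw [← neg_one_mul (exp _), ← exp_neg_pi_mul_I, ← exp_add]
    congr 1
    change _ = -(piC * I) + _
    field_simp [piC_ne_zero]
    ring
  rw [theta1_eq_jacobiTheta₂, theta1_eq_jacobiTheta₂,
    show (z + piC * τ) / piC + (τ + 1) / 2 = z / piC + (τ + 1) / 2 + τ by
      field_simp [piC_ne_zero]; ring,
    jacobiTheta₂_add_left']
  change _ * (_ * (exp (-(piC : ℂ) * I * (τ + 2 * (z / piC + (τ + 1) / 2))) * _)) = _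
  have h2 : exp (I * (z + piC * τ)) * exp (-(2 * piC * I * τ + 2 * I * z)) =
      exp (-(piC * I * τ + 2 * I * z)) * exp (I * z) := by
    rw [← exp_add, ← exp_add]
    congr 1
    ring
  rw [h]
  linear_combination (I * exp (piC * I * τ / 4) * jacobiTheta₂ (z / piC + (τ + 1) / 2) τ) * h2

lemma theta1_neg (z τ : ℂ) : theta1 (-z) τ = -theta1 z τ := by
  have h : exp (-(piC : ℂ) * I * (τ + 2 * (z / piC + (1 - τ) / 2))) = -exp (-(2 * I * z)) := by
    rw [← neg_one_mul (exp _), ← exp_neg_pi_mul_I, ← exp_add]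
    congr 1
    change _ = -(piC * I) + _
    field_simp [piC_ne_zero]
    ring
  have h2 : exp (I * z) * exp (-(2 * I * z)) = exp (I * -z) := by
    rw [← exp_add]
    congr 1
    ring
  have h3 : jacobiTheta₂ (-z / piC + (τ + 1) / 2) τ = jacobiTheta₂ (z / piC + (1 - τ) / 2) τ := by
    rw [← jacobiTheta₂_neg_left, ← jacobiTheta₂_add_left]
    congr 1
    ring
  rw [theta1_eq_jacobiTheta₂, theta1_eq_jacobiTheta₂, h3,
    show z / piC + (τ + 1) / 2 = z / piC + (1 - τ) / 2 + τ by ring, jacobiTheta₂_add_left']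
  change _ = -(_ * (_ * (exp (-(piC : ℂ) * I * (τ + 2 * (z / piC + (1 - τ) / 2))) * _)))
  rw [h]
  linear_combination
    (I * exp (piC * I * τ / 4) * jacobiTheta₂ (z / piC + (1 - τ) / 2) τ) * h2

lemma exists_theta1_ne_zero {τ : ℂ} (hτ : 0 < τ.im) : ∃ z, theta1 z τ ≠ 0 := by
  by_contra! h
  have hz : ∀ w : ℂ, jacobiTheta₂ w τ = 0 := by
    intro w
    have h1 := h (piC * (w - (τ + 1) / 2))
    rw [theta1_eq_jacobiTheta₂, mul_div_cancel_left₀ _ piC_ne_zero, sub_add_cancel] at h1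
    simpa [exp_ne_zero] using h1
  have := integral_jacobiTheta₂ hτ
  simp [hz] at this

/-- The kernel `θ₁(x - y) θ₁(x + y) θ₁(2x) θ₁(2y)` is not identically zero. -/
lemma exists_theta1_kernel_ne_zero {τ : ℂ} (hτ : 0 < τ.im) : ∃ x y : ℂ,
    theta1 (x - y) τ * theta1 (x + y) τ * theta1 (2 * x) τ * theta1 (2 * y) τ ≠ 0 := by
  obtain ⟨u, hu⟩ := exists_theta1_ne_zero hτ
  have hd := differentiable_theta1 hτ
  have h1 : ∀ᶠ v in nhdsWithin (0 : ℂ) {0}ᶜ, theta1 v τ ≠ 0 := by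
    by_contra hf
    have := AnalyticOnNhd.eq_of_frequently_eq (z₀ := (0 : ℂ)) (fun z _ => hd.analyticAt z)
      (analyticOnNhd_const (v := (0 : ℂ))) (by simpa only [Filter.not_eventually, not_not] using hf)
    exact hu (congrFun this u)
  have h2 : ∀ᶠ v in nhdsWithin (0 : ℂ) {0}ᶜ, theta1 (u + v) τ ≠ 0 := by
    refine nhdsWithin_le_nhds
      (ContinuousAt.eventually_ne (g := fun v => theta1 (u + v) τ) ?_ (by simpa using hu))
    exact (hd.continuous.comp (continuous_const_add u)).continuousAt
  have h3 : ∀ᶠ v in nhdsWithin (0 : ℂ) {0}ᶜ, theta1 (u - v) τ ≠ 0 := by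
    refine nhdsWithin_le_nhds
      (ContinuousAt.eventually_ne (g := fun v => theta1 (u - v) τ) ?_ (by simpa using hu))
    exact (hd.continuous.comp (continuous_const.sub continuous_id)).continuousAt
  obtain ⟨v, hv1, hv2, hv3⟩ := (h1.and (h2.and h3)).exists
  refine ⟨(u + v) / 2, (u - v) / 2, ?_⟩
  rw [show (u + v) / 2 - (u - v) / 2 = v by ring, show (u + v) / 2 + (u - v) / 2 = u by ring,
    mul_div_cancel₀ _ two_ne_zero, mul_div_cancel₀ _ two_ne_zero]
  exact mul_ne_zero (mul_ne_zero (mul_ne_zero hv1 hu) hv2) hv3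

/-- The odd entire functions with the quasi-periodicity of a theta function of degree six. -/
def oddTheta (τ : ℂ) : Submodule ℂ (ℂ → ℂ) where
  carrier := {h | Differentiable ℂ h ∧ (∀ z, h (z + piC) = h z) ∧
    (∀ z, h z = qq τ ^ 3 * exp (12 * I * z) * h (z + piC * τ)) ∧ ∀ z, h (-z) = -h z}
  zero_mem' := ⟨differentiable_const 0, by simp, by simp, by simp⟩
  add_mem' := by
    rintro f g ⟨hf, hf1, hf2, hf3⟩ ⟨hg, hg1, hg2, hg3⟩
    refine ⟨hf.add hg, fun z => ?_, fun z => ?_, fun z => ?_⟩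
    · simp only [Pi.add_apply, hf1, hg1]
    · simp only [Pi.add_apply]
      linear_combination hf2 z + hg2 z
    · simp only [Pi.add_apply, hf3, hg3]
      ring
  smul_mem' := by
    rintro c f ⟨hf, hf1, hf2, hf3⟩
    refine ⟨hf.const_smul c, fun z => ?_, fun z => ?_, fun z => ?_⟩
    · simp only [Pi.smul_apply, hf1]
    · simp only [Pi.smul_apply, smul_eq_mul]
      linear_combination c * hf2 z
    · simp only [Pi.smul_apply, hf3, smul_neg]

/-- The odd part of a theta function of degree six. -/
lemma sub_comp_neg_mem_oddTheta {τ : ℂ} {F : ℂ → ℂ} (hF : Differentiable ℂ F)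
    (hF1 : ∀ z : ℂ, F z = F (z + piC))
    (hF2 : ∀ z : ℂ, F z = qq τ ^ 3 * exp (12 * I * z) * F (z + piC * τ)) :
    (fun z => F z - F (-z)) ∈ oddTheta τ := by
  refine ⟨hF.sub (hF.comp differentiable_neg), fun z => ?_, fun z => ?_, fun z => ?_⟩
  · have h := hF1 (-(z + piC))
    rw [show -(z + piC) + piC = -z by ring] at h
    simp only [h, ← hF1 z]
  · have h := hF2 (-(z + piC * τ))
    rw [show -(z + piC * τ) + piC * τ = -z by ring] at h
    have he : qq τ ^ 3 * exp (12 * I * z) *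
        (qq τ ^ 3 * exp (12 * I * -(z + piC * τ))) = 1 := by
      simp only [qq, ← exp_nat_mul, ← exp_add]
      rw [← exp_zero]
      congr 1
      push_cast
      ring
    simp only [h]
    linear_combination hF2 z + F (-z) * he
  · simp

/-- As a function of its first variable the kernel lies in `oddTheta τ`. -/
lemma theta1_kernel_mem_oddTheta {τ : ℂ} (hτ : 0 < τ.im) (y : ℂ) :
    (fun x => theta1 (x - y) τ * theta1 (x + y) τ * theta1 (2 * x) τ * theta1 (2 * y) τ) ∈
      oddTheta τ := by
  refine ⟨?_, fun z => ?_, fun z => ?_, fun z => ?_⟩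
  · have hd := differentiable_theta1 hτ
    have h1 : Differentiable ℂ fun x => theta1 (x - y) τ :=
      hd.comp (f := fun x => x - y) (by fun_prop)
    have h2 : Differentiable ℂ fun x => theta1 (x + y) τ :=
      hd.comp (f := fun x => x + y) (by fun_prop)
    have h3 : Differentiable ℂ fun x => theta1 (2 * x) τ :=
      hd.comp (f := fun x => 2 * x) (by fun_prop)
    fun_prop
  · simp only [show z + piC - y = z - y + piC by ring, show z + piC + y = z + y + piC by ring,
      show 2 * (z + piC) = 2 * z + piC + piC by ring, theta1_add_pi]
    ring
  · simp only [show z + piC * τ - y = z - y + piC * τ by ring,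
      show z + piC * τ + y = z + y + piC * τ by ring,
      show 2 * (z + piC * τ) = 2 * z + piC * τ + piC * τ by ring, theta1_add_pi_mul]
    have he : qq τ ^ 3 * exp (12 * I * z) * (exp (-(piC * I * τ + 2 * I * (z - y))) *
        exp (-(piC * I * τ + 2 * I * (z + y))) *
        exp (-(piC * I * τ + 2 * I * (2 * z + piC * τ))) *
        exp (-(piC * I * τ + 2 * I * (2 * z)))) = 1 := by
      simp only [qq, ← exp_nat_mul, ← exp_add]
      rw [← exp_zero]
      congr 1
      push_cast
      ring
    linear_combination
      (-theta1 (z - y) τ * theta1 (z + y) τ * theta1 (2 * z) τ * theta1 (2 * y) τ) * he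
  · simp only [show -z - y = -(z + y) by ring, show -z + y = -(z - y) by ring,
      show 2 * -z = -(2 * z) by ring, theta1_neg]
    ring

/-- The integral of a `T`-periodic entire function over a period does not depend on the
starting point. -/
lemma integral_add_eq_of_periodic {g : ℂ → ℂ} (hg : Differentiable ℂ g) {T : ℝ}
    (hT : ∀ z, g (z + T) = g z) (w : ℂ) :
    ∫ x in (0 : ℝ)..T, g (x + w) = ∫ x in (0 : ℝ)..T, g x := by
  have hrect := integral_boundary_rect_eq_zero_of_differentiableOn g 0 (T + w.im * I)
    hg.differentiableOn
  have hside : ∀ y : ℝ, g (T + y * I) = g (y * I) := fun y => by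
    rw [add_comm, hT]
  simp [hside] at hrect
  have hper : Function.Periodic (fun x : ℝ => g (x + w.im * I)) T := fun x => by
    simp only [ofReal_add]
    rw [add_right_comm, hT]
  have hshift := hper.intervalIntegral_add_eq w.re 0
  rw [zero_add] at hshift
  have htrans := intervalIntegral.integral_comp_add_right (a := 0) (b := T)
    (fun x : ℝ => g (x + w.im * I)) w.re
  rw [zero_add, add_comm T] at htrans
  rw [sub_eq_zero.1 hrect, ← hshift, ← htrans]
  simp [add_assoc, re_add_im]

/-- The Fourier coefficients, up to a factor `π`, of a function on `ℂ` with period `π`. -/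
def coeffPi (h : ℂ → ℂ) (n : ℤ) : ℂ :=
  ∫ x in (0 : ℝ)..Real.pi, h x * exp (-(2 * I * n * x))

lemma exp_two_I_int_add_pi (n : ℤ) (z : ℂ) :
    exp (-(2 * I * n * (z + (Real.pi : ℂ)))) = exp (-(2 * I * n * z)) := by
  rw [mul_add, neg_add, exp_add, show -(2 * I * n * (Real.pi : ℂ)) =
    ((-n : ℤ) : ℂ) * (2 * Real.pi * I) by push_cast; ring, exp_int_mul_two_pi_mul_I, mul_one]

lemma coeffPi_add_six {τ : ℂ} {h : ℂ → ℂ} (hh : h ∈ oddTheta τ) (n : ℤ) :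
    coeffPi h (n + 6) = qq τ ^ (n + 3) * coeffPi h n := by
  obtain ⟨hd, h1, h2, -⟩ := hh
  have hs := integral_add_eq_of_periodic (g := fun z => h z * exp (-(2 * I * n * z)))
    (by fun_prop) (T := Real.pi)
    (fun z => by rw [exp_two_I_int_add_pi]; exact congrArg (· * _) (h1 z)) (piC * τ)
  rw [coeffPi, coeffPi, ← hs, ← intervalIntegral.integral_const_mul]
  congr 1
  funext x
  rw [h2 x]
  have he : exp (12 * I * x) * exp (-(2 * I * ((n + 6 : ℤ) : ℂ) * x)) * qq τ ^ 3 =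
      qq τ ^ (n + 3) * exp (-(2 * I * n * (x + piC * τ))) := by
    simp only [qq, ← exp_nat_mul, ← exp_int_mul, ← exp_add]
    congr 1
    push_cast
    ring
  linear_combination h (x + piC * τ) * he

lemma coeffPi_neg {τ : ℂ} {h : ℂ → ℂ} (hh : h ∈ oddTheta τ) (n : ℤ) :
    coeffPi h (-n) = -coeffPi h n := by
  obtain ⟨-, h1, -, h3⟩ := hh
  have hper : Function.Periodic (fun x : ℝ => h x * exp (-(2 * I * n * x))) Real.pi := fun x => by
    simp only [ofReal_add]
    rw [exp_two_I_int_add_pi]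
    exact congrArg (· * _) (h1 x)
  have hs := hper.intervalIntegral_add_eq (-Real.pi) 0
  rw [neg_add_cancel, zero_add] at hs
  have hneg := intervalIntegral.integral_comp_neg (a := 0) (b := Real.pi)
    (fun x : ℝ => h x * exp (-(2 * I * n * x)))
  rw [neg_zero, hs] at hneg
  rw [coeffPi, coeffPi, ← hneg, ← intervalIntegral.integral_neg]
  congr 1
  funext x
  simp [h3]

/-- An entire function with period `π` is determined by its Fourier coefficients. -/
lemma eq_zero_of_coeffPi_eq_zero {h : ℂ → ℂ} (hd : Differentiable ℂ h)
    (h1 : ∀ z, h (z + piC) = h z) (hc : ∀ n, coeffPi h n = 0) : h = 0 := by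
  have : Fact (0 < Real.pi) := ⟨Real.pi_pos⟩
  have hper : Function.Periodic (fun x : ℝ => h x) Real.pi := fun x => by
    simp only [ofReal_add]
    exact h1 x
  have hcont : Continuous (fun x : ℝ => h x) := hd.continuous.comp continuous_ofReal
  let f : C(AddCircle Real.pi, ℂ) := ⟨hper.lift, continuous_coinduced_dom.mpr hcont⟩
  have hf : ∀ x : ℝ, f x = h x := fun x => hper.lift_coe x
  have hcoeff : fourierCoeff f = 0 := by
    funext n
    rw [fourierCoeff_eq_intervalIntegral _ n 0, Pi.zero_apply, zero_add]
    have : ∫ x in (0 : ℝ)..Real.pi, fourier (-n) (x : AddCircle Real.pi) • f x = coeffPi h n := by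
      rw [coeffPi]
      congr 1
      funext x
      rw [hf, fourier_coe_apply, smul_eq_mul, mul_comm]
      congr 2
      push_cast
      field_simp [Real.pi_ne_zero]
    rw [this, hc, smul_zero]
  have hreal : ∀ x : ℝ, h x = 0 := fun x => by
    have hs := has_pointwise_sum_fourier_series_of_summable (f := f)
      (by rw [hcoeff]; exact summable_zero) x
    rw [hcoeff, hf] at hs
    simpa using hs.unique (by simp)
  refine AnalyticOnNhd.eq_of_frequently_eq (z₀ := ((0 : ℝ) : ℂ)) (fun z _ => hd.analyticAt z)
    (fun z _ => analyticAt_const (v := (0 : ℂ))) ?_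
  have ht : Filter.Tendsto ((↑) : ℝ → ℂ) (nhdsWithin 0 {0}ᶜ)
      (nhdsWithin ((0 : ℝ) : ℂ) {((0 : ℝ) : ℂ)}ᶜ) :=
    continuous_ofReal.continuousWithinAt.tendsto_nhdsWithin fun x hx => by simpa using hx
  exact ht.frequently (Filter.Eventually.of_forall hreal).frequently

/-- The space `oddTheta τ` embeds into `ℂ × ℂ` through two Fourier coefficients. -/
def oddThetaCoeff (τ : ℂ) : oddTheta τ →ₗ[ℂ] ℂ × ℂ where
  toFun h := (coeffPi h 1, coeffPi h 2)
  map_add' f g := by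
    have hi : ∀ (h : oddTheta τ) (n : ℤ), IntervalIntegrable
        (fun x : ℝ => (h : ℂ → ℂ) x * exp (-(2 * I * n * x))) MeasureTheory.volume 0 Real.pi := by
      intro h n
      have := h.2.1.continuous
      exact Continuous.intervalIntegrable (by fun_prop) _ _
    have : ∀ n, coeffPi (f + g : oddTheta τ) n = coeffPi f n + coeffPi g n := fun n => by
      simp only [coeffPi]
      rw [← intervalIntegral.integral_add (hi f n) (hi g n)]
      simp [add_mul]
    simp only [this, Prod.mk_add_mk]
  map_smul' c f := by
    have : ∀ n, coeffPi (c • f : oddTheta τ) n = c * coeffPi f n := fun n => by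
      simp only [coeffPi]
      rw [← intervalIntegral.integral_const_mul]
      simp [mul_assoc]
    simp only [this, RingHom.id_apply, Prod.smul_mk, smul_eq_mul]

lemma oddThetaCoeff_injective (τ : ℂ) : Function.Injective (oddThetaCoeff τ) := by
  rw [← LinearMap.ker_eq_bot, LinearMap.ker_eq_bot']
  intro h hh
  obtain ⟨c1, c2⟩ : coeffPi h 1 = 0 ∧ coeffPi h 2 = 0 := Prod.mk_eq_zero.1 hh
  have hq : qq τ ≠ 0 := exp_ne_zero _
  have hstep : ∀ n, coeffPi h (n + 6) = 0 ↔ coeffPi h n = 0 := fun n => by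
    rw [coeffPi_add_six h.2, mul_eq_zero, or_iff_right (zpow_ne_zero _ hq)]
  have c0 : coeffPi h 0 = 0 := by
    have := coeffPi_neg h.2 0
    rw [neg_zero] at this
    exact self_eq_neg.1 this
  have c3 : coeffPi h 3 = 0 := by
    have h6 := coeffPi_add_six h.2 (-3)
    have hn := coeffPi_neg h.2 3
    norm_num at h6
    rw [h6] at hn
    rw [h6]
    exact self_eq_neg.1 hn
  have c4 : coeffPi h 4 = 0 := by
    have := hstep (-2)
    rw [coeffPi_neg h.2, c2, neg_zero] at this
    norm_num at this
    exact this
  have c5 : coeffPi h 5 = 0 := by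
    have := hstep (-1)
    rw [coeffPi_neg h.2, c1, neg_zero] at this
    norm_num at this
    exact this
  have hshift : ∀ k r : ℤ, coeffPi h (r + 6 * k) = 0 ↔ coeffPi h r = 0 := by
    intro k r
    induction k with
    | zero => simp
    | succ k ih => rw [← ih, ← hstep (r + 6 * k)]; ring_nf
    | pred k ih => rw [← ih, ← hstep (r + 6 * (-k - 1))]; ring_nf
  refine Subtype.ext (eq_zero_of_coeffPi_eq_zero h.2.1 h.2.2.1 fun n => ?_)
  rw [← Int.emod_add_mul_ediv n 6, hshift]
  have hlow := Int.emod_nonneg n (b := 6) (by norm_num)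
  have hhigh := Int.emod_lt_of_pos n (b := 6) (by norm_num)
  generalize n % 6 = r at *
  obtain rfl | rfl | rfl | rfl | rfl | rfl :
    r = 0 ∨ r = 1 ∨ r = 2 ∨ r = 3 ∨ r = 4 ∨ r = 5 := by omega
  exacts [c0, c1, c2, c3, c4, c5]

/-- Evaluation at two points is injective on `oddTheta τ` as soon as it is surjective. -/
lemma oddTheta_ext_of_surjective {τ x₀ y₀ : ℂ}
    (hs : ∀ a b : ℂ, ∃ h ∈ oddTheta τ, h x₀ = a ∧ h y₀ = b)
    {h : ℂ → ℂ} (hh : h ∈ oddTheta τ) (hx : h x₀ = 0) (hy : h y₀ = 0) : h = 0 := by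
  let ev : oddTheta τ →ₗ[ℂ] ℂ × ℂ :=
    ((LinearMap.proj x₀).prod (LinearMap.proj y₀)).comp (oddTheta τ).subtype
  have hsurj : Function.Surjective ev := by
    rintro ⟨a, b⟩
    obtain ⟨g, hg, hgx, hgy⟩ := hs a b
    exact ⟨⟨g, hg⟩, Prod.ext hgx hgy⟩
  have hinj := oddThetaCoeff_injective τ
  have : Module.Finite ℂ (oddTheta τ) := Module.Finite.of_injective _ hinj
  have hrank : Module.finrank ℂ (oddTheta τ) = Module.finrank ℂ (ℂ × ℂ) :=
    le_antisymm (LinearMap.finrank_le_finrank_of_injective hinj)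
      (LinearMap.finrank_le_finrank_of_surjective hsurj)
  have hev := (LinearMap.injective_iff_surjective_of_finrank_eq_finrank hrank).2 hsurj
  have : (⟨h, hh⟩ : oddTheta τ) = 0 := hev (by rw [map_zero]; exact Prod.ext hx hy)
  exact congrArg Subtype.val this

/-- Two antisymmetric kernels whose slices lie in `oddTheta τ` are proportional, provided the
second one does not vanish identically. -/
lemma antisymm_kernel_proportional {τ : ℂ} {D K : ℂ → ℂ → ℂ}
    (hD : ∀ y, (fun x => D x y) ∈ oddTheta τ) (hK : ∀ y, (fun x => K x y) ∈ oddTheta τ)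
    (hDa : ∀ x y, D y x = -D x y) (hKa : ∀ x y, K y x = -K x y)
    {x₀ y₀ : ℂ} (hne : K x₀ y₀ ≠ 0) (x y : ℂ) :
    D x y = D x₀ y₀ / K x₀ y₀ * K x y := by
  have hself : ∀ z, K z z = 0 := fun z => self_eq_neg.1 (hKa z z)
  have hself' : ∀ z, D z z = 0 := fun z => self_eq_neg.1 (hDa z z)
  have key : ∀ h ∈ oddTheta τ, ∀ x,
      h x = h x₀ / K x₀ y₀ * K x y₀ - h y₀ / K x₀ y₀ * K x x₀ := by
    intro h hh x
    have hmem := (oddTheta τ).sub_mem hh ((oddTheta τ).sub_mem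
      ((oddTheta τ).smul_mem (h x₀ / K x₀ y₀) (hK y₀))
      ((oddTheta τ).smul_mem (h y₀ / K x₀ y₀) (hK x₀)))
    have hz := oddTheta_ext_of_surjective (x₀ := x₀) (y₀ := y₀) (fun a b => ?_) hmem ?_ ?_
    · simpa [sub_eq_zero] using congrFun hz x
    · refine ⟨_, (oddTheta τ).sub_mem ((oddTheta τ).smul_mem (a / K x₀ y₀) (hK y₀))
        ((oddTheta τ).smul_mem (b / K x₀ y₀) (hK x₀)), ?_, ?_⟩
      · simp [hself, hne]
      · simp [hself, hne, hKa x₀ y₀]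
    · simp [hself, hne]
    · simp [hself, hne, hKa x₀ y₀]
  have slice : ∀ {E : ℂ → ℂ → ℂ}, (∀ y, (fun x => E x y) ∈ oddTheta τ) →
      (∀ x y, E y x = -E x y) → (∀ z, E z z = 0) →
      E x y * K x₀ y₀ ^ 2 = E x₀ y₀ * (K x y₀ * K y x₀ * -1 + K x x₀ * K y y₀) := by
    intro E hE hEa hEs
    have e1 := key _ (hE y) x
    have e2 := key _ (hE x₀) y
    have e3 := key _ (hE y₀) y
    simp only [hEs, hEa x₀ y₀] at e1 e2 e3
    rw [hEa y x₀, hEa y y₀, e2, e3] at e1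
    rw [e1]
    field_simp
    ring
  have hd := slice hD hDa hself'
  have hk := slice hK hKa hself
  have hk0 : K x y * K x₀ y₀ = K x y₀ * K y x₀ * -1 + K x x₀ * K y y₀ :=
    mul_left_cancel₀ hne (by linear_combination hk)
  rw [← hk0] at hd
  field_simp
  exact mul_right_cancel₀ hne (by linear_combination hd)

theorem statement16 (τ : ℂ) (hτ : 0 < τ.im) (F G : ℂ → ℂ)
    (hF : Differentiable ℂ F) (hG : Differentiable ℂ G)
    (hF1 : ∀ z : ℂ, F z = F (z + piC))
    (hF2 : ∀ z : ℂ, F z = qq τ ^ 3 * exp (12 * I * z) * F (z + piC * τ))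
    (hG1 : ∀ z : ℂ, G z = G (z + piC))
    (hG2 : ∀ z : ℂ, G z = qq τ ^ 3 * exp (12 * I * z) * G (z + piC * τ)) :
    ∃ C : ℂ, ∀ x y : ℂ,
      (F x - F (-x)) * (G y - G (-y)) - (F y - F (-y)) * (G x - G (-x)) =
        C * theta1 (x - y) τ * theta1 (x + y) τ * theta1 (2 * x) τ * theta1 (2 * y) τ := by
  obtain ⟨x₀, y₀, hne⟩ := exists_theta1_kernel_ne_zero hτ
  have hf := sub_comp_neg_mem_oddTheta hF hF1 hF2
  have hg := sub_comp_neg_mem_oddTheta hG hG1 hG2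
  have key := antisymm_kernel_proportional (τ := τ)
    (D := fun x y => (F x - F (-x)) * (G y - G (-y)) - (F y - F (-y)) * (G x - G (-x)))
    (K := fun x y => theta1 (x - y) τ * theta1 (x + y) τ * theta1 (2 * x) τ * theta1 (2 * y) τ)
    (fun y => ?_) (theta1_kernel_mem_oddTheta hτ) (fun x y => by ring) (fun x y => ?_) hne
  · simp only [← mul_assoc] at key
    exact ⟨_, key⟩
  · convert (oddTheta τ).sub_mem ((oddTheta τ).smul_mem (G y - G (-y)) hf)
      ((oddTheta τ).smul_mem (F y - F (-y)) hg) using 1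
    funext x
    simp only [Pi.sub_apply, Pi.smul_apply, smul_eq_mul]
    ring
  · rw [show y - x = -(x - y) by ring, theta1_neg, add_comm y x]
    ring
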